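/- Let F be a finite nonempty subset of the s-dimensional torus [0,1)^s with box discrepancy D(F), and let Ξ ⊆ [0,1)^s be a domain belonging to the class S_h for an increasing function h with h(ε) → 0 as ε → 0. Then the discrepancy of F with respect to Ξ satisfies Δ(F, Ξ) ≪ h(s^{1/2} · D(F)^{1/s}), with implied constant depending only on s. -/

import Mathlib

/-- One-dimensional Abel summation. -/
theorem abel_fin (M : ℕ) (a e : Fin (M + 1) → ℝ) :
    ∑ j, a j * e j = a (Fin.last M) * ∑ i, e i
      - ∑ j : Fin M, (a j.succ - a j.castSucc) * ∑ i, (if i ≤ j.castSucc then e i else 0) := by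
  induction M with
  | zero => simp
  | succ M ih =>
    rw [Fin.sum_univ_castSucc, ih (fun j => a j.castSucc) (fun j => e j.castSucc)]
    rw [Fin.sum_univ_castSucc (fun j : Fin (M + 1) => (a j.succ - a j.castSucc) * _)]
    rw [Fin.sum_univ_castSucc e]
    have h1 : ∀ j : Fin (M + 1), ∑ i : Fin (M + 1 + 1), (if i ≤ j.castSucc then e i else 0)
        = ∑ i : Fin (M + 1), (if i ≤ j then e i.castSucc else 0) := by
      intro j
      rw [Fin.sum_univ_castSucc]
      have : ¬ (Fin.last (M + 1) ≤ j.castSucc) := by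
        simp [Fin.le_def]
        omega
      simp [this]
    simp only [h1, Fin.succ_last, Fin.succ_castSucc]
    have h2 : ∀ i : Fin (M + 1), i ≤ Fin.last M := fun i => Fin.le_last i
    simp only [h2, if_true]
    ring

theorem sum_cons {s n : ℕ} (f : (Fin (s + 1) → Fin n) → ℝ) :
    ∑ k, f k = ∑ j : Fin n, ∑ k : Fin s → Fin n, f (Fin.cons j k) := by
  rw [← Fintype.sum_prod_type']
  exact (Fintype.sum_equiv (Fin.consEquiv (fun _ => Fin n)) _ _ (fun x => rfl)).symm

theorem sum_succ_castSucc_le (M : ℕ) (b : Fin (M + 1) → ℝ) (hb : ∀ j, 0 ≤ b j) :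
    ∑ j : Fin M, (b j.succ + b j.castSucc) ≤ 2 * ∑ j, b j := by
  rw [Finset.sum_add_distrib]
  have h1 := Fin.sum_univ_succ b
  have h2 := Fin.sum_univ_castSucc b
  have := hb 0
  have := hb (Fin.last M)
  linarith

open Classical in
theorem key (M : ℕ) (D : ℝ) (hD : 0 ≤ D) : ∀ (s : ℕ) (a b e : (Fin s → Fin (M + 1)) → ℝ),
    (∀ k, 0 ≤ b k) →
    (∀ (k : Fin s → Fin (M + 1)) (i : Fin s) (j : Fin M),
      |a (Function.update k i j.succ) - a (Function.update k i j.castSucc)| ≤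
        b (Function.update k i j.succ) + b (Function.update k i j.castSucc)) →
    (∀ n : Fin s → Fin (M + 1), |∑ k, (if k ≤ n then e k else 0)| ≤ D) →
    |∑ k, a k * e k - a (fun _ => Fin.last M) * ∑ k, e k| ≤ D * (3 ^ s - 1) * ∑ k, b k := by
  intro s
  induction s with
  | zero =>
    intro a b e hb hab he
    simp [Unique.eq_default]
  | succ s ih =>
    intro a b e hb hab he
    set E : Fin (M + 1) → (Fin s → Fin (M + 1)) → ℝ :=
      fun j k => ∑ i, (if i ≤ j then e (Fin.cons i k) else 0) with hE
    have htop : (fun _ => Fin.last M : Fin (s + 1) → Fin (M + 1))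
        = Fin.cons (Fin.last M) (fun _ => Fin.last M) := by
      funext i; refine Fin.cases ?_ (fun i => ?_) i <;> simp
    have hElast : ∀ k, E (Fin.last M) k = ∑ i, e (Fin.cons i k) := by
      intro k; simp [hE, Fin.le_last]
    have hEbox : ∀ j (n : Fin s → Fin (M + 1)), |∑ k, (if k ≤ n then E j k else 0)| ≤ D := by
      intro j n
      have := he (Fin.cons j n)
      rw [sum_cons, Finset.sum_comm] at this
      convert this using 3 with k
      simp only [Fin.cons_le_cons, hE]
      by_cases hk : k ≤ n <;> simp [hk]
    have habs : ∑ k, a k * e k = ∑ k, a (Fin.cons (Fin.last M) k) * E (Fin.last M) k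
        - ∑ j : Fin M, ∑ k, (a (Fin.cons j.succ k) - a (Fin.cons j.castSucc k))
            * E j.castSucc k := by
      rw [sum_cons, Finset.sum_comm, Finset.sum_comm (s := (Finset.univ : Finset (Fin M))),
        ← Finset.sum_sub_distrib]
      refine Finset.sum_congr rfl (fun k _ => ?_)
      rw [abel_fin M (fun j => a (Fin.cons j k)) (fun j => e (Fin.cons j k)), hElast]
    have hupd : ∀ (j : Fin (M + 1)) (k : Fin s → Fin (M + 1)) (i : Fin s) (x : Fin (M + 1)),
        (Fin.cons j (Function.update k i x) : Fin (s + 1) → Fin (M + 1))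
          = Function.update (Fin.cons j k) i.succ x := by
      intro j k i x; exact Fin.cons_update ..
    have hupd0 : ∀ (j x : Fin (M + 1)) (k : Fin s → Fin (M + 1)),
        Function.update (Fin.cons j k : Fin (s + 1) → Fin (M + 1)) 0 x = Fin.cons x k := by
      intro j x k; exact Fin.update_cons_zero ..
    have h1 := ih (fun k => a (Fin.cons (Fin.last M) k)) (fun k => b (Fin.cons (Fin.last M) k))
      (E (Fin.last M)) (fun k => hb _) (fun k i j => by
        simp only [hupd]; exact hab _ _ _) (hEbox _)
    have h2 : ∀ j : Fin M, |∑ k, (a (Fin.cons j.succ k) - a (Fin.cons j.castSucc k))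
            * E j.castSucc k| ≤ D * (3 ^ s) *
              ∑ k, (b (Fin.cons j.succ k) + b (Fin.cons j.castSucc k)) := by
      intro j
      have h := ih (fun k => a (Fin.cons j.succ k) - a (Fin.cons j.castSucc k))
        (fun k => b (Fin.cons j.succ k) + b (Fin.cons j.castSucc k))
        (E j.castSucc) (fun k => add_nonneg (hb _) (hb _)) (fun k i l => by
          simp only [hupd]
          have h1 := hab (Fin.cons j.succ k) i.succ l
          have h2 := hab (Fin.cons j.castSucc k) i.succ l
          rw [abs_le] at h1 h2 ⊢
          constructor <;> linarith [h1.1, h1.2, h2.1, h2.2]) (hEbox _)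
      have hall := hEbox j.castSucc (fun _ => Fin.last M)
      have hle : ∀ k : Fin s → Fin (M + 1), k ≤ (fun _ => Fin.last M) :=
        fun k i => Fin.le_last _
      simp only [hle, if_true] at hall
      have h3 := hab (Fin.cons j.succ (fun _ => Fin.last M)) 0 j
      simp only [hupd0] at h3
      have h4 : b (Fin.cons j.succ (fun _ => Fin.last M)) +
          b (Fin.cons j.castSucc (fun _ => Fin.last M)) ≤
          ∑ k, (b (Fin.cons j.succ k) + b (Fin.cons j.castSucc k)) :=
        Finset.single_le_sum (f := fun k : Fin s → Fin (M + 1) =>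
          b (Fin.cons j.succ k) + b (Fin.cons j.castSucc k))
          (fun k _ => add_nonneg (hb _) (hb _)) (Finset.mem_univ (fun _ => Fin.last M))
      have h5 := mul_le_mul (h3.trans h4) hall (abs_nonneg _)
        (Finset.sum_nonneg (fun k _ => add_nonneg (hb _) (hb _)))
      rw [← abs_mul] at h5
      have h6 := abs_add_le (∑ k, (a (Fin.cons j.succ k) - a (Fin.cons j.castSucc k))
            * E j.castSucc k - (a (Fin.cons j.succ (fun _ => Fin.last M)) - a (Fin.cons j.castSucc (fun _ => Fin.last M))) * ∑ k, E j.castSucc k)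
            ((a (Fin.cons j.succ (fun _ => Fin.last M)) - a (Fin.cons j.castSucc (fun _ => Fin.last M))) * ∑ k, E j.castSucc k)
      rw [sub_add_cancel] at h6
      linarith
    have h3 : |∑ j : Fin M, ∑ k, (a (Fin.cons j.succ k) - a (Fin.cons j.castSucc k))
            * E j.castSucc k| ≤ D * 3 ^ s * (2 * ∑ k, b k) := by
      refine (Finset.abs_sum_le_sum_abs _ _).trans ((Finset.sum_le_sum (fun j _ => h2 j)).trans ?_)
      rw [← Finset.mul_sum]
      refine mul_le_mul_of_nonneg_left ?_ (by positivity)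
      rw [sum_cons b]
      simp only [Finset.sum_add_distrib (s := (Finset.univ : Finset (Fin s → Fin (M + 1))))]
      exact sum_succ_castSucc_le M (fun j => ∑ k, b (Fin.cons j k))
        (fun j => Finset.sum_nonneg (fun k _ => hb _))
    have h4 : ∑ k, b (Fin.cons (Fin.last M) k) ≤ ∑ k, b k := by
      rw [sum_cons b]
      exact Finset.single_le_sum (f := fun j => ∑ k, b (Fin.cons j k))
        (fun j _ => Finset.sum_nonneg (fun k _ => hb _)) (Finset.mem_univ (Fin.last M))
    have h5 : ∑ k, e k = ∑ k, E (Fin.last M) k := by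
      simp only [hElast]
      rw [sum_cons, Finset.sum_comm]
    have h6 : D * (3 ^ s - 1) * ∑ k, b (Fin.cons (Fin.last M) k) ≤ D * (3 ^ s - 1) * ∑ k, b k := by
      refine mul_le_mul_of_nonneg_left h4 (mul_nonneg hD ?_)
      have : (1 : ℝ) ≤ 3 ^ s := one_le_pow₀ (by norm_num)
      linarith
    rw [habs, h5, htop]
    rw [abs_le] at h1 h3 ⊢
    have : D * (3 ^ (s + 1) - 1) * ∑ k, b k = D * (3 ^ s - 1) * ∑ k, b k
      + D * 3 ^ s * (2 * ∑ k, b k) := by ring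
    constructor <;> linarith [h1.1, h1.2, h3.1, h3.2]

open MeasureTheory

/-- The half-open unit cube. -/
def Kc (s : ℕ) : Set (EuclideanSpace ℝ (Fin s)) := {x | ∀ i, 0 ≤ x i ∧ x i < 1}

/-- Half-open grid cube of side `1/(M+1)`. -/
def Qc {s : ℕ} (M : ℕ) (k : Fin s → Fin (M + 1)) : Set (EuclideanSpace ℝ (Fin s)) :=
  {x | ∀ i, ((k i : ℕ) : ℝ) ≤ ((M : ℝ) + 1) * x i ∧ ((M : ℝ) + 1) * x i < ((k i : ℕ) : ℝ) + 1}

theorem Qc_sub {s M : ℕ} (k : Fin s → Fin (M + 1)) : Qc M k ⊆ Kc s := by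
  intro x hx i
  have h := hx i
  have hM : (0 : ℝ) < (M : ℝ) + 1 := by positivity
  have hk : ((k i : ℕ) : ℝ) + 1 ≤ (M : ℝ) + 1 := by exact_mod_cast (k i).isLt
  have h0 : (0 : ℝ) ≤ ((k i : ℕ) : ℝ) := by positivity
  constructor
  · by_contra hc
    push Not at hc
    nlinarith [h.1]
  · by_contra hc
    push Not at hc
    nlinarith [h.2]

theorem Qc_exists {s : ℕ} (M : ℕ) {x : EuclideanSpace ℝ (Fin s)} (hx : x ∈ Kc s) :
    ∃ k : Fin s → Fin (M + 1), x ∈ Qc M k := by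
  have hM : (0 : ℝ) < (M : ℝ) + 1 := by positivity
  have h0 : ∀ i, 0 ≤ ((M : ℝ) + 1) * x i := fun i => mul_nonneg hM.le (hx i).1
  refine ⟨fun i => ⟨⌊((M : ℝ) + 1) * x i⌋₊, ?_⟩, fun i => ⟨?_, ?_⟩⟩
  · rw [Nat.floor_lt (h0 i)]
    push_cast
    nlinarith [(hx i).2]
  · exact Nat.floor_le (h0 i)
  · exact Nat.lt_floor_add_one _

theorem Qc_unique {s M : ℕ} {k l : Fin s → Fin (M + 1)} {x : EuclideanSpace ℝ (Fin s)}
    (hk : x ∈ Qc M k) (hl : x ∈ Qc M l) : k = l := by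
  funext i
  have h1 := hk i
  have h2 := hl i
  have h3 : ((k i : ℕ) : ℝ) < (l i : ℕ) + 1 := by linarith
  have h4 : ((l i : ℕ) : ℝ) < (k i : ℕ) + 1 := by linarith
  norm_cast at h3 h4
  ext
  omega

theorem Qc_eq {s M : ℕ} (k : Fin s → Fin (M + 1)) :
    Qc M k = (MeasurableEquiv.toLp 2 (Fin s → ℝ)).symm ⁻¹'
      (Set.pi Set.univ fun i => Set.Ico (((k i : ℕ) : ℝ) / ((M : ℝ) + 1))
        ((((k i : ℕ) : ℝ) + 1) / ((M : ℝ) + 1))) := by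
  ext x
  have hM : (0 : ℝ) < (M : ℝ) + 1 := by positivity
  simp [Qc, Set.mem_pi, div_le_iff₀ hM, lt_div_iff₀ hM, mul_comm]

theorem Qc_meas {s M : ℕ} (k : Fin s → Fin (M + 1)) : MeasurableSet (Qc M k) := by
  rw [Qc_eq]
  exact (MeasurableEquiv.measurable _) (MeasurableSet.univ_pi fun i => measurableSet_Ico)

theorem Qc_vol {s M : ℕ} (k : Fin s → Fin (M + 1)) :
    volume (Qc M k) = ENNReal.ofReal (((M : ℝ) + 1)⁻¹ ^ s) := by
  rw [Qc_eq, (EuclideanSpace.volume_preserving_symm_measurableEquiv_toLp (Fin s)).measure_preimage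
    (MeasurableSet.univ_pi fun i => measurableSet_Ico).nullMeasurableSet, Real.volume_pi_Ico]
  have : ∀ i, ((((k i : ℕ) : ℝ) + 1) / ((M : ℝ) + 1)) - (((k i : ℕ) : ℝ) / ((M : ℝ) + 1))
    = ((M : ℝ) + 1)⁻¹ := by intro i; field_simp; ring
  simp only [this]
  rw [← ENNReal.ofReal_prod_of_nonneg (fun i _ => by positivity)]
  simp

theorem union_vol {s M : ℕ} (S : Finset (Fin s → Fin (M + 1))) :
    volume (⋃ k ∈ S, Qc M k) = ENNReal.ofReal (S.card * ((M : ℝ) + 1)⁻¹ ^ s) := by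
  rw [measure_biUnion_finset]
  · simp only [Qc_vol]
    rw [Finset.sum_const, nsmul_eq_mul, ENNReal.ofReal_mul (by positivity), ENNReal.ofReal_natCast]
  · intro k _ l _ hkl
    rw [Function.onFun, Set.disjoint_left]
    intro x hx hx'
    exact hkl (Qc_unique hx hx')
  · intro k _; exact Qc_meas k

theorem Kc_eq (s : ℕ) : Kc s = (MeasurableEquiv.toLp 2 (Fin s → ℝ)).symm ⁻¹'
      (Set.pi Set.univ fun _ => Set.Ico 0 1) := by
  ext x; simp [Kc, Set.mem_pi]

theorem Kc_meas (s : ℕ) : MeasurableSet (Kc s) := by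
  rw [Kc_eq]
  exact (MeasurableEquiv.measurable _) (MeasurableSet.univ_pi fun i => measurableSet_Ico)

theorem Kc_vol (s : ℕ) : volume (Kc s) = 1 := by
  rw [Kc_eq, (EuclideanSpace.volume_preserving_symm_measurableEquiv_toLp (Fin s)).measure_preimage
    (MeasurableSet.univ_pi fun i => measurableSet_Ico).nullMeasurableSet, Real.volume_pi_Ico]
  simp

theorem dist_lt_of {s : ℕ} (hs : 1 ≤ s) {x y : EuclideanSpace ℝ (Fin s)} {c : ℝ}
    (h : ∀ i, |x i - y i| < c) : dist x y < Real.sqrt s * c := by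
  have hc : 0 < c := (abs_nonneg _).trans_lt (h ⟨0, hs⟩)
  rw [EuclideanSpace.dist_eq]
  have : Real.sqrt s * c = Real.sqrt (∑ i : Fin s, c ^ 2) := by
    simp [Real.sqrt_sq hc.le]
  rw [this]
  refine Real.sqrt_lt_sqrt (Finset.sum_nonneg fun i _ => sq_nonneg _) ?_
  refine Finset.sum_lt_sum_of_nonempty ⟨⟨0, hs⟩, Finset.mem_univ _⟩ fun i _ => ?_
  rw [Real.dist_eq]
  exact pow_lt_pow_left₀ (h i) (abs_nonneg _) (by norm_num)

theorem infDist_lt {s : ℕ} {x y : EuclideanSpace ℝ (Fin s)} {A : Set (EuclideanSpace ℝ (Fin s))}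
    {c : ℝ} (hy : y ∈ A) (h : dist x y < c) : Metric.infDist x A < c :=
  (Metric.infDist_le_dist_of_mem hy).trans_lt h

/-- Outer boundary layer of `X`. -/
def Wp {s : ℕ} (X : Set (EuclideanSpace ℝ (Fin s))) (ε : ℝ) : Set (EuclideanSpace ℝ (Fin s)) :=
  {u | u ∈ Kc s ∧ u ∉ X ∧ Metric.infDist u X < ε}

/-- Inner boundary layer of `X`. -/
def Wm {s : ℕ} (X : Set (EuclideanSpace ℝ (Fin s))) (ε : ℝ) : Set (EuclideanSpace ℝ (Fin s)) :=
  {u | u ∈ X ∧ Metric.infDist u (Kc s \ X) < ε}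

theorem mixed {s M : ℕ} (hs : 1 ≤ s) {X : Set (EuclideanSpace ℝ (Fin s))} {ε : ℝ}
    (hε : Real.sqrt s * ((M : ℝ) + 1)⁻¹ ≤ ε) {k : Fin s → Fin (M + 1)}
    (h1 : ¬ Qc M k ⊆ X) (h2 : (Qc M k ∩ X).Nonempty) : Qc M k ⊆ Wp X ε ∪ Wm X ε := by
  obtain ⟨w, hw, hwX⟩ := Set.not_subset.1 h1
  obtain ⟨v, hv, hvX⟩ := h2
  have hM : (0 : ℝ) < (M : ℝ) + 1 := by positivity
  have hd : ∀ x ∈ Qc M k, ∀ y ∈ Qc M k, dist x y < ε := by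
    intro x hx y hy
    refine (dist_lt_of hs (c := ((M : ℝ) + 1)⁻¹) fun i => ?_).trans_le hε
    have h1 := hx i
    have h2 := hy i
    rw [inv_eq_one_div, lt_div_iff₀ hM, show |x i - y i| * ((M : ℝ) + 1) = |(x i - y i) * ((M : ℝ) + 1)| by
      rw [abs_mul, abs_of_pos hM], abs_lt]
    constructor <;> nlinarith
  intro u hu
  by_cases huX : u ∈ X
  · exact Or.inr ⟨huX, infDist_lt ⟨Qc_sub k hw, hwX⟩ (hd u hu w hw)⟩
  · exact Or.inl ⟨Qc_sub k hu, huX, infDist_lt hvX (hd u hu v hv)⟩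

theorem shifted {s M : ℕ} (hs : 1 ≤ s) {X : Set (EuclideanSpace ℝ (Fin s))} {ε : ℝ}
    (hε : Real.sqrt s * ((M : ℝ) + 1)⁻¹ < ε) {k l : Fin s → Fin (M + 1)} {i : Fin s} {σ : ℝ}
    (hσ : |σ| = 1) (hl : ∀ j, ((l j : ℕ) : ℝ) = ((k j : ℕ) : ℝ) + if j = i then σ else 0)
    (h1 : ¬ Qc M k ⊆ X) (h2 : Qc M l ⊆ X) : Qc M k ⊆ Wp X ε ∪ Wm X ε := by
  by_cases h3 : (Qc M k ∩ X).Nonempty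
  · exact mixed hs hε.le h1 h3
  have hM : (0 : ℝ) < (M : ℝ) + 1 := by positivity
  intro u hu
  have huX : u ∉ X := fun h => h3 ⟨u, hu, h⟩
  refine Or.inl ⟨Qc_sub k hu, huX, ?_⟩
  set v : EuclideanSpace ℝ (Fin s) := u + EuclideanSpace.single i (σ * ((M : ℝ) + 1)⁻¹) with hv
  have hvQ : v ∈ Qc M l := by
    intro j
    have hj := hu j
    rw [hl j]
    have : ((M : ℝ) + 1) * v j = ((M : ℝ) + 1) * u j + if j = i then σ else 0 := by
      simp only [hv, PiLp.add_apply, EuclideanSpace.single_apply]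
      split_ifs
      · field_simp
      · ring
    rw [this]
    constructor <;> linarith [hj.1, hj.2]
  refine infDist_lt (h2 hvQ) ?_
  rw [dist_comm, dist_eq_norm]
  have : v - u = EuclideanSpace.single i (σ * ((M : ℝ) + 1)⁻¹) := by simp [hv]
  rw [this, EuclideanSpace.norm_single, Real.norm_eq_abs, abs_mul, hσ, one_mul,
    abs_of_pos (by positivity)]
  refine lt_of_le_of_lt ?_ hε
  have : (1 : ℝ) ≤ Real.sqrt s := by
    rw [Real.one_le_sqrt]; exact_mod_cast hs
  nlinarith [inv_pos.2 hM]

open Classical in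
theorem core {s M : ℕ} (hs : 1 ≤ s) (F : Finset (EuclideanSpace ℝ (Fin s)))
    (X : Set (EuclideanSpace ℝ (Fin s))) (D ε H : ℝ) (hF : F.Nonempty)
    (hFK : ∀ x ∈ F, x ∈ Kc s) (hX : X ⊆ Kc s)
    (hε : Real.sqrt s * ((M : ℝ) + 1)⁻¹ < ε)
    (hp : (volume (Wp X ε)).toReal ≤ H) (hm : (volume (Wm X ε)).toReal ≤ H) (hD : 0 ≤ D)
    (hbox : ∀ α β : Fin s → ℝ, (∀ i, 0 ≤ α i ∧ α i ≤ β i ∧ β i ≤ 1) →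
          |((F.filter (fun x => ∀ i, α i ≤ x i ∧ x i < β i)).card : ℝ) / (F.card : ℝ) -
              ∏ i, (β i - α i)| ≤ D) :
    (volume X).toReal - ((F.filter (fun x => x ∈ X)).card : ℝ) / (F.card : ℝ) ≤
      (D * 3 ^ s * ((M : ℝ) + 1) ^ s + 1) * (2 * H) := by
  have hM : (0 : ℝ) < (M : ℝ) + 1 := by positivity
  have hN : (0 : ℝ) < F.card := by exact_mod_cast hF.card_pos
  set q : ℝ := ((M : ℝ) + 1)⁻¹ ^ s with hq
  have hq0 : 0 < q := by positivity
  set N : ℝ := (F.card : ℝ) with hNdef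
  set c : (Fin s → Fin (M + 1)) → ℝ := fun k => ∑ x ∈ F, if x ∈ Qc M k then (1 : ℝ) else 0 with hc
  set e : (Fin s → Fin (M + 1)) → ℝ := fun k => c k / N - q with he
  set a : (Fin s → Fin (M + 1)) → ℝ := fun k => if Qc M k ⊆ X then 1 else 0 with ha
  set b : (Fin s → Fin (M + 1)) → ℝ :=
    fun k => if Qc M k ⊆ Wp X ε ∪ Wm X ε then 1 else 0 with hb
  have hb0 : ∀ k, 0 ≤ b k := by intro k; simp only [hb]; split_ifs <;> norm_num
  -- a general double counting identity
  have hcount : ∀ g : (Fin s → Fin (M + 1)) → ℝ, ∀ G : EuclideanSpace ℝ (Fin s) → ℝ,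
      (∀ x ∈ F, ∀ k, x ∈ Qc M k → g k = G x) → ∑ k, g k * c k = ∑ x ∈ F, G x := by
    intro g G hgG
    simp only [hc, Finset.mul_sum]
    rw [Finset.sum_comm]
    refine Finset.sum_congr rfl fun x hx => ?_
    obtain ⟨k, hk⟩ := Qc_exists M (hFK x hx)
    rw [Finset.sum_eq_single k]
    · simp [hk, hgG x hx k hk]
    · intro l _ hl
      have : x ∉ Qc M l := fun h => hl (Qc_unique h hk)
      simp [this]
    · simp
  -- box sums
  have hboxes : ∀ n : Fin s → Fin (M + 1), ∑ k, (if k ≤ n then e k else 0) =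
      ((F.filter (fun x => ∀ i, (0 : ℝ) ≤ x i ∧ x i < (((n i : ℕ) : ℝ) + 1) / ((M : ℝ) + 1))).card : ℝ) / N
        - ∏ i, ((((n i : ℕ) : ℝ) + 1) / ((M : ℝ) + 1) - 0) := by
    intro n
    have h1 : ∑ k, (if k ≤ n then e k else 0) = (∑ k, (if k ≤ n then (1 : ℝ) else 0) * c k) / N
        - ∑ k, (if k ≤ n then q else 0) := by
      rw [Finset.sum_div, ← Finset.sum_sub_distrib]
      refine Finset.sum_congr rfl fun k _ => ?_
      split_ifs <;> simp [he]
    rw [h1]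
    congr 1
    · congr 1
      rw [hcount _ (fun x => if ∀ i, (0 : ℝ) ≤ x i ∧ x i < (((n i : ℕ) : ℝ) + 1) / ((M : ℝ) + 1) then 1 else 0)]
      · simp
      · intro x hx k hk
        congr 1
        apply propext
        constructor
        · intro hkn i
          refine ⟨(hFK x hx i).1, ?_⟩
          rw [lt_div_iff₀ hM, mul_comm]
          have h1 : ((k i : ℕ) : ℝ) ≤ (n i : ℕ) := by exact_mod_cast hkn i
          linarith [(hk i).2]
        · intro h i
          have h2 := (h i).2
          rw [lt_div_iff₀ hM, mul_comm] at h2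
          have h3 : ((k i : ℕ) : ℝ) < (n i : ℕ) + 1 := lt_of_le_of_lt (hk i).1 h2
          norm_cast at h3
          exact Fin.le_def.2 (by omega)
    · rw [← Finset.sum_filter, Finset.sum_const, nsmul_eq_mul]
      have h2 : (Finset.univ.filter fun k : Fin s → Fin (M + 1) => k ≤ n) = Finset.Iic n := by
        ext k; simp
      rw [h2, Pi.card_Iic]
      simp only [Fin.card_Iic, sub_zero]
      rw [Finset.prod_div_distrib]
      push_cast
      simp [hq, div_eq_mul_inv]
  have hebox : ∀ n : Fin s → Fin (M + 1), |∑ k, (if k ≤ n then e k else 0)| ≤ D := by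
    intro n
    rw [hboxes n]
    refine hbox (fun _ => 0) _ fun i => ⟨le_rfl, by positivity, ?_⟩
    rw [div_le_one hM]
    exact_mod_cast (n i).isLt
  have hetot : ∑ k, e k = 0 := by
    have h := hboxes (fun _ => Fin.last M)
    have hle : ∀ k : Fin s → Fin (M + 1), k ≤ (fun _ => Fin.last M) := fun k i => Fin.le_last _
    simp only [hle, if_true] at h
    rw [h]
    have hfl : ∀ G : Finset (EuclideanSpace ℝ (Fin s)), (∀ x, x ∈ G ↔ x ∈ F) → (G.card : ℝ) = N := by
      intro G hG
      rw [hNdef, Finset.ext hG]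
    rw [hfl]
    · simp [div_self hN.ne', div_self hM.ne']
    · intro x
      simp only [Finset.mem_filter, Fin.val_last, div_self hM.ne']
      exact ⟨fun h => h.1, fun h => ⟨h, hFK x h⟩⟩
  have hab : ∀ (k : Fin s → Fin (M + 1)) (i : Fin s) (j : Fin M),
      |a (Function.update k i j.succ) - a (Function.update k i j.castSucc)| ≤
        b (Function.update k i j.succ) + b (Function.update k i j.castSucc) := by
    intro k i j
    set k1 := Function.update k i j.succ with hk1
    set k2 := Function.update k i j.castSucc with hk2
    have h12 : ∀ l, ((k1 l : ℕ) : ℝ) = ((k2 l : ℕ) : ℝ) + if l = i then 1 else 0 := by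
      intro l
      by_cases hl : l = i
      · subst hl; simp [hk1, hk2]
      · simp [hk1, hk2, hl]
    have h21 : ∀ l, ((k2 l : ℕ) : ℝ) = ((k1 l : ℕ) : ℝ) + if l = i then -1 else 0 := by
      intro l
      rw [h12 l]; split_ifs <;> ring
    by_cases h1 : Qc M k1 ⊆ X <;> by_cases h2 : Qc M k2 ⊆ X
    · simp only [ha, h1, h2, if_true, sub_self, abs_zero]; exact add_nonneg (hb0 _) (hb0 _)
    · have h3 : b k2 = 1 := if_pos (shifted hs hε (by norm_num) h12 h2 h1)
      simp only [ha, h1, h2, if_true, if_false, h3]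
      have := hb0 k1
      norm_num; exact this
    · have h3 : b k1 = 1 := if_pos (shifted hs hε (by norm_num) h21 h1 h2)
      simp only [ha, h1, h2, if_true, if_false, h3]
      have := hb0 k2
      norm_num; exact this
    · simp only [ha, h1, h2, if_false, sub_self, abs_zero]; exact add_nonneg (hb0 _) (hb0 _)
  have hkey := key M D hD s a b e hb0 hab hebox
  rw [hetot, mul_zero, sub_zero] at hkey
  -- lower bound of the count
  have hcnt : ∑ k, a k * c k ≤ ((F.filter (fun x => x ∈ X)).card : ℝ) := by
    rw [hcount a (fun x => if ∃ k, x ∈ Qc M k ∧ Qc M k ⊆ X then 1 else 0)]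
    · have : ((F.filter (fun x => x ∈ X)).card : ℝ) = ∑ x ∈ F, if x ∈ X then (1 : ℝ) else 0 := by
        simp
      rw [this]
      refine Finset.sum_le_sum fun x _ => ?_
      by_cases h : ∃ k, x ∈ Qc M k ∧ Qc M k ⊆ X
      · obtain ⟨k, hk, hkX⟩ := h
        rw [if_pos (hkX hk)]; split_ifs <;> norm_num
      · rw [if_neg h]; split_ifs <;> norm_num
    · intro x _ k hk
      simp only [ha]
      congr 1
      apply propext
      constructor
      · intro h; exact ⟨k, hk, h⟩
      · rintro ⟨l, hl, h⟩; rwa [Qc_unique hk hl]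
  -- volume of X
  have hvol : (volume X).toReal ≤ ∑ k, a k * q + ∑ k, b k * q := by
    set A := Finset.univ.filter fun k : Fin s → Fin (M + 1) => Qc M k ⊆ X with hA
    set B := Finset.univ.filter fun k : Fin s → Fin (M + 1) => Qc M k ⊆ Wp X ε ∪ Wm X ε with hB
    have hcov : X ⊆ (⋃ k ∈ A, Qc M k) ∪ ⋃ k ∈ B, Qc M k := by
      intro x hx
      obtain ⟨k, hk⟩ := Qc_exists M (hX hx)
      by_cases hkX : Qc M k ⊆ X
      · exact Or.inl (Set.mem_biUnion (x := k) (by simp [hA, hkX]) hk)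
      · refine Or.inr (Set.mem_biUnion (x := k) ?_ hk)
        simp only [hB, Finset.coe_filter, Finset.mem_univ, true_and, Set.mem_setOf_eq]
        exact mixed hs hε.le hkX ⟨x, hk, hx⟩
    have h1 := (measure_mono hcov).trans (measure_union_le (μ := volume) _ _)
    rw [union_vol, union_vol, ← ENNReal.ofReal_add (by positivity) (by positivity)] at h1
    have h2 := ENNReal.toReal_le_of_le_ofReal (by positivity) h1
    refine h2.trans (le_of_eq ?_)
    rw [← Finset.sum_mul, ← Finset.sum_mul]
    simp only [ha, hb, hA, hB, Finset.sum_boole, hq]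
  -- boundary volume
  have hbd : ∑ k, b k * q ≤ 2 * H := by
    set B := Finset.univ.filter fun k : Fin s → Fin (M + 1) => Qc M k ⊆ Wp X ε ∪ Wm X ε with hB
    have hsub : (⋃ k ∈ B, Qc M k) ⊆ Wp X ε ∪ Wm X ε := by
      refine Set.iUnion₂_subset fun k hk => ?_
      simpa [hB] using hk
    have h1 := (measure_mono hsub).trans (measure_union_le (μ := volume) _ _)
    have fin : ∀ Y : Set (EuclideanSpace ℝ (Fin s)), Y ⊆ Kc s → volume Y ≠ ⊤ := by
      intro Y hY
      exact ((measure_mono hY).trans_lt (by rw [Kc_vol]; exact ENNReal.one_lt_top)).ne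
    have f1 := fin (Wp X ε) fun u hu => hu.1
    have f2 := fin (Wm X ε) fun u hu => hX hu.1
    have h2 := ENNReal.toReal_mono (ENNReal.add_ne_top.2 ⟨f1, f2⟩) h1
    rw [ENNReal.toReal_add f1 f2, union_vol, ENNReal.toReal_ofReal (by positivity)] at h2
    have h3 : ∑ k, b k * q = B.card * q := by
      rw [← Finset.sum_mul]
      simp only [hb, hB, Finset.sum_boole]
    rw [h3]; linarith
  have hae : ∑ k, a k * e k = (∑ k, a k * c k) / N - ∑ k, a k * q := by
    rw [Finset.sum_div, ← Finset.sum_sub_distrib]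
    refine Finset.sum_congr rfl fun k _ => ?_
    simp only [he]; ring
  have hcnt' := div_le_div_of_nonneg_right hcnt hN.le
  have hB0 : 0 ≤ ∑ k, b k := Finset.sum_nonneg fun k _ => hb0 k
  have hqM : q * ((M : ℝ) + 1) ^ s = 1 := by
    rw [hq, ← mul_pow, inv_mul_cancel₀ hM.ne', one_pow]
  have h3 : D * (3 ^ s - 1) * ∑ k, b k ≤ D * 3 ^ s * ((M : ℝ) + 1) ^ s * (2 * H) := by
    calc D * (3 ^ s - 1) * ∑ k, b k ≤ D * 3 ^ s * ∑ k, b k := by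
          refine mul_le_mul_of_nonneg_right ?_ hB0
          exact mul_le_mul_of_nonneg_left (by linarith) hD
      _ = D * 3 ^ s * ((M : ℝ) + 1) ^ s * ∑ k, b k * q := by
          rw [← Finset.sum_mul]; linear_combination (-(D * 3 ^ s * ∑ k, b k)) * hqM
      _ ≤ _ := mul_le_mul_of_nonneg_left hbd (by positivity)
  have h4 := (abs_le.1 hkey).1
  linarith

open Classical in
theorem oneside {s : ℕ} (hs : 1 ≤ s) (F : Finset (EuclideanSpace ℝ (Fin s)))
    (X : Set (EuclideanSpace ℝ (Fin s))) (D H : ℝ) (hF : F.Nonempty)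
    (hFK : ∀ x ∈ F, x ∈ Kc s) (hX : X ⊆ Kc s)
    (hp : (volume (Wp X (Real.sqrt s * D ^ ((1 : ℝ) / s)))).toReal ≤ H)
    (hm : (volume (Wm X (Real.sqrt s * D ^ ((1 : ℝ) / s)))).toReal ≤ H) (hD : 0 < D)
    (hbox : ∀ α β : Fin s → ℝ, (∀ i, 0 ≤ α i ∧ α i ≤ β i ∧ β i ≤ 1) →
          |((F.filter (fun x => ∀ i, α i ≤ x i ∧ x i < β i)).card : ℝ) / (F.card : ℝ) -
              ∏ i, (β i - α i)| ≤ D) :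
    (volume X).toReal - ((F.filter (fun x => x ∈ X)).card : ℝ) / (F.card : ℝ) ≤
      (2 * (6 ^ s + 1)) * H := by
  have hH : 0 ≤ H := ENNReal.toReal_nonneg.trans hp
  have hs0 : (0 : ℝ) < s := by exact_mod_cast hs
  have hsq : 0 < Real.sqrt s := Real.sqrt_pos.2 hs0
  set r := D ^ ((1 : ℝ) / s) with hr
  have hr0 : 0 < r := Real.rpow_pos_of_pos hD _
  have hrs : r ^ s = D := by
    rw [hr, one_div, Real.rpow_inv_natCast_pow hD.le (by omega)]
  rcases le_or_gt 1 D with h1 | h1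
  · have hr1 : 1 ≤ r := Real.one_le_rpow h1 (by positivity)
    have hW : Wm X (Real.sqrt s * r) = X := by
      ext u
      refine ⟨fun h => h.1, fun h => ⟨h, ?_⟩⟩
      rcases (Kc s \ X).eq_empty_or_nonempty with h0 | ⟨v, hv⟩
      · rw [h0, Metric.infDist_empty]; positivity
      · refine infDist_lt hv ((dist_lt_of hs (c := 1) fun i => ?_).trans_le ?_)
        · have h2 := hX h i
          have h3 := hv.1 i
          rw [abs_lt]; constructor <;> linarith [h2.1, h2.2, h3.1, h3.2]
        · nlinarith
    rw [hW] at hm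
    have : 0 ≤ ((F.filter (fun x => x ∈ X)).card : ℝ) / (F.card : ℝ) := by positivity
    have h6 : (0 : ℝ) < 6 ^ s := by positivity
    nlinarith
  · have hr1 : r < 1 := Real.rpow_lt_one hD.le h1 (by positivity)
    have h2 : r⁻¹ < (⌊r⁻¹⌋₊ : ℝ) + 1 := Nat.lt_floor_add_one _
    have h3 : (⌊r⁻¹⌋₊ : ℝ) ≤ r⁻¹ := Nat.floor_le (by positivity)
    have h4 : (1 : ℝ) < r⁻¹ := (one_lt_inv₀ hr0).2 hr1
    set M := ⌊r⁻¹⌋₊ with hMd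
    have hM : (0 : ℝ) < (M : ℝ) + 1 := by positivity
    have h5 := core (M := M) hs F X D (Real.sqrt s * r) H hF hFK hX
      (mul_lt_mul_of_pos_left (inv_lt_of_inv_lt₀ hr0 h2) hsq) hp hm hD.le hbox
    refine h5.trans ?_
    have h6 : D * 3 ^ s * ((M : ℝ) + 1) ^ s ≤ 6 ^ s := by
      rw [← hrs, ← mul_pow, ← mul_pow]
      refine pow_le_pow_left₀ (by positivity) ?_ _
      have : r * r⁻¹ = 1 := mul_inv_cancel₀ hr0.ne'
      nlinarith
    nlinarith

open MeasureTheory in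
open Classical in
/-- Laczkovich's inequality: for a finite set `F ⊆ [0,1)^s` with box discrepancy
at most `D`, and a domain `Ξ` in the class `S_h`, the discrepancy of `F` with
respect to `Ξ` is `≪ h(√s · D^{1/s})`, with implied constant depending only
on `s`. -/
theorem stmt_10 (s : ℕ) (hs : 1 ≤ s) :
    ∃ Cst : ℝ, 0 < Cst ∧
      ∀ (F : Finset (EuclideanSpace ℝ (Fin s))) (h : ℝ → ℝ)
        (Ξ : Set (EuclideanSpace ℝ (Fin s))) (D : ℝ),
        F.Nonempty →
        (∀ x ∈ F, ∀ i, 0 ≤ x i ∧ x i < 1) →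
        MonotoneOn h (Set.Ioi (0 : ℝ)) →
        Filter.Tendsto h (nhdsWithin 0 (Set.Ioi 0)) (nhds 0) →
        Ξ ⊆ {x : EuclideanSpace ℝ (Fin s) | ∀ i, 0 ≤ x i ∧ x i < 1} →
        MeasurableSet Ξ →
        (∀ ε : ℝ, 0 < ε →
          (volume {u : EuclideanSpace ℝ (Fin s) |
              (∀ i, 0 ≤ u i ∧ u i < 1) ∧ u ∉ Ξ ∧ Metric.infDist u Ξ < ε}).toReal ≤ h ε ∧
          (volume {u : EuclideanSpace ℝ (Fin s) |
              u ∈ Ξ ∧ Metric.infDist u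
                {v : EuclideanSpace ℝ (Fin s) | (∀ i, 0 ≤ v i ∧ v i < 1) ∧ v ∉ Ξ} < ε}).toReal
            ≤ h ε) →
        0 ≤ D →
        (∀ α β : Fin s → ℝ, (∀ i, 0 ≤ α i ∧ α i ≤ β i ∧ β i ≤ 1) →
          |((F.filter (fun x => ∀ i, α i ≤ x i ∧ x i < β i)).card : ℝ) / (F.card : ℝ) -
              ∏ i, (β i - α i)| ≤ D) →
        |((F.filter (fun x => x ∈ Ξ)).card : ℝ) / (F.card : ℝ) - (volume Ξ).toReal| ≤
          Cst * h (Real.sqrt s * D ^ ((1 : ℝ) / s)) := by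
  refine ⟨2 * (6 ^ s + 1), by positivity, ?_⟩
  intro F h Ξ D hF hFK _ _ hΞ hmeas hS hD0 hbox
  have hs0 : (0 : ℝ) < s := by exact_mod_cast hs
  have hN : (0 : ℝ) < F.card := by exact_mod_cast hF.card_pos
  have hD : 0 < D := by
    obtain ⟨x, hx⟩ := hF
    by_contra hneg
    have hDz : D = 0 := le_antisymm (not_lt.1 hneg) hD0
    -- a box at `x` of side `t`, and its half
    obtain ⟨t, ht0, ht1, htN⟩ : ∃ t : ℝ, 0 < t ∧ (∀ i, x i + t ≤ 1) ∧ t < 1 / F.card := by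
      have hev : ∀ᶠ t in nhdsWithin (0 : ℝ) (Set.Ioi 0),
          0 < t ∧ (∀ i, x i + t ≤ 1) ∧ t < 1 / F.card := by
        refine Filter.Eventually.and self_mem_nhdsWithin (Filter.Eventually.and ?_ ?_)
        · rw [Filter.eventually_all]
          intro i
          refine nhdsWithin_le_nhds ?_
          filter_upwards [Iio_mem_nhds (sub_pos.2 (hFK x hx i).2)] with t ht
          have : t < 1 - x i := ht
          linarith
        · exact nhdsWithin_le_nhds (Iio_mem_nhds (by positivity))
      exact hev.exists
    have h1 := hbox (fun i => x i) (fun i => x i + t) fun i =>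
      ⟨(hFK x hx i).1, by linarith, ht1 i⟩
    have h2 : (1 : ℝ) ≤ ((F.filter (fun y => ∀ i, x i ≤ y i ∧ y i < x i + t)).card : ℝ) := by
      have : 0 < (F.filter (fun y => ∀ i, x i ≤ y i ∧ y i < x i + t)).card :=
        Finset.card_pos.2 ⟨x, by simp [hx, ht0]⟩
      exact_mod_cast this
    have h3 := div_le_div_of_nonneg_right h2 hN.le
    have h4 : ∏ i : Fin s, (x i + t - x i) ≤ t := by
      have ht1' : t ≤ 1 := by linarith [ht1 ⟨0, hs⟩, (hFK x hx ⟨0, hs⟩).1]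
      simp only [add_sub_cancel_left, Finset.prod_const, Finset.card_univ, Fintype.card_fin]
      exact pow_le_of_le_one ht0.le ht1' (by omega)
    have h5 := (abs_le.1 h1).2
    linarith
  have hε : 0 < Real.sqrt s * D ^ ((1 : ℝ) / s) :=
    mul_pos (Real.sqrt_pos.2 hs0) (Real.rpow_pos_of_pos hD _)
  obtain ⟨hp, hm⟩ := hS _ hε
  have hΞK : Ξ ⊆ Kc s := hΞ
  have hcc : Kc s \ (Kc s \ Ξ) = Ξ := Set.sdiff_sdiff_cancel_left hΞK
  have h1 := oneside hs F Ξ D _ hF hFK hΞK hp hm hD hbox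
  have hp' : Wp (Kc s \ Ξ) (Real.sqrt s * D ^ ((1 : ℝ) / s))
      = Wm Ξ (Real.sqrt s * D ^ ((1 : ℝ) / s)) := by
    ext u
    constructor
    · rintro ⟨hu, hu', hd⟩
      exact ⟨by_contra fun hc => hu' ⟨hu, hc⟩, hd⟩
    · rintro ⟨hu, hd⟩
      exact ⟨hΞK hu, fun hc => hc.2 hu, hd⟩
  have hm' : Wm (Kc s \ Ξ) (Real.sqrt s * D ^ ((1 : ℝ) / s))
      = Wp Ξ (Real.sqrt s * D ^ ((1 : ℝ) / s)) := by
    ext u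
    simp only [Wm, Wp, hcc, Set.mem_setOf_eq, Set.mem_sdiff, and_assoc]
  have h2 := oneside hs F (Kc s \ Ξ) D (h (Real.sqrt s * D ^ ((1 : ℝ) / s))) hF hFK
    Set.sdiff_subset (by rw [hp']; exact hm) (by rw [hm']; exact hp) hD hbox
  have hfin : volume Ξ ≠ ⊤ :=
    ((measure_mono hΞK).trans_lt (by rw [Kc_vol]; exact ENNReal.one_lt_top)).ne
  have hv : (volume (Kc s \ Ξ)).toReal = 1 - (volume Ξ).toReal := by
    rw [measure_sdiff hΞK hmeas.nullMeasurableSet hfin, ENNReal.toReal_sub_of_le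
      (measure_mono hΞK) (by rw [Kc_vol]; exact ENNReal.one_ne_top), Kc_vol, ENNReal.toReal_one]
  have hcard : ((F.filter (fun x => x ∈ Kc s \ Ξ)).card : ℝ) / (F.card : ℝ)
      = 1 - ((F.filter (fun x => x ∈ Ξ)).card : ℝ) / (F.card : ℝ) := by
    have h3 : F.filter (fun x => x ∈ Kc s \ Ξ) = F.filter (fun x => ¬ x ∈ Ξ) :=
      Finset.filter_congr fun x hx => ⟨fun h => h.2, fun h => ⟨hFK x hx, h⟩⟩
    have h4 := Finset.card_filter_add_card_filter_not (s := F) (fun x => x ∈ Ξ)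
    rw [h3, eq_sub_iff_add_eq, ← add_div, div_eq_one_iff_eq hN.ne']
    rw [add_comm]
    exact_mod_cast h4
  rw [hv] at h2
  have h2' : 1 - (volume Ξ).toReal - (1 - ((F.filter (fun x => x ∈ Ξ)).card : ℝ) / (F.card : ℝ)) ≤
      2 * (6 ^ s + 1) * h (Real.sqrt s * D ^ ((1 : ℝ) / s)) := by
    rw [← hcard]
    convert h2
  rw [abs_le]
  constructor <;> linarith
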